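/- A connected graph G contains k edge-disjoint spanning trees if and only if for every partition (V_1, ..., V_t) of V(G), the number of edges of G joining different parts is at least k(t−1). -/

import Mathlib

namespace SimpleGraph

variable {V : Type*} {ι : Type*}

lemma Reachable.of_forall_adj {H K : SimpleGraph V} (h : ∀ a b, H.Adj a b → K.Reachable a b)
    {a b : V} (hab : H.Reachable a b) : K.Reachable a b := by
  obtain ⟨p⟩ := hab
  induction p with
  | nil => exact Reachable.refl _
  | cons hadj _ ih => exact (h _ _ hadj).trans ih

/-- The graph obtained from `H` by replacing the edge `f` with an edge joining `u` and `v`. -/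
def exchangeEdge (H : SimpleGraph V) (f : Sym2 V) (u v : V) : SimpleGraph V :=
  H.deleteEdges {f} ⊔ edge u v

lemma edgeSet_exchangeEdge (H : SimpleGraph V) (f : Sym2 V) {u v : V} (huv : u ≠ v) :
    (H.exchangeEdge f u v).edgeSet = insert s(u, v) (H.edgeSet \ {f}) := by
  ext e
  simp only [exchangeEdge, edgeSet_sup, edgeSet_deleteEdges, edgeSet_edge_of_ne huv]
  simp

/-- Exchanging an edge on a path for an edge joining the ends of the path preserves
reachability. -/
lemma reachable_exchangeEdge_iff {H : SimpleGraph V} {u v : V} (huv : u ≠ v)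
    (hnadj : ¬ H.Adj u v) {p : H.Walk u v} (hp : p.IsPath) {f : Sym2 V} (hf : f ∈ p.edges)
    (a b : V) : (H.exchangeEdge f u v).Reachable a b ↔ H.Reachable a b := by
  have hfH : f ∈ H.edgeSet := p.edges_subset_edgeSet hf
  have hne : f ≠ s(u, v) := by
    rintro rfl
    exact hnadj hfH
  constructor
  · refine Reachable.of_forall_adj fun a b hab ↦ ?_
    rw [← mem_edgeSet, edgeSet_exchangeEdge H f huv] at hab
    rcases hab with hab | hab
    · rcases Sym2.eq_iff.mp hab with ⟨rfl, rfl⟩ | ⟨rfl, rfl⟩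
      · exact ⟨p⟩
      · exact ⟨p.reverse⟩
    · exact Adj.reachable hab.1
  · refine Reachable.of_forall_adj fun a b hab ↦ ?_
    by_cases hfab : s(a, b) = f
    · have hle : H ≤ H ⊔ edge u v := le_sup_left
      have hvu : (H ⊔ edge u v).Adj v u := by simp [edge_adj, huv.symm]
      have hcyc : (Walk.cons hvu (p.mapLe hle)).IsCycle := by
        rw [Walk.cons_isCycle_iff]
        refine ⟨hp.mapLe hle, ?_⟩
        rw [Walk.edges_mapLe_eq_edges, Sym2.eq_swap]
        exact fun h ↦ hnadj (p.edges_subset_edgeSet h)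
      have hbr : ¬ (H ⊔ edge u v).IsBridge f := fun h ↦ by
        rw [isBridge_iff_forall_cycle_notMem (edgeSet_mono hle hfH)] at h
        exact h _ hcyc (by simp [hf])
      subst hfab
      rw [isBridge_iff, not_not] at hbr
      refine hbr.mono ?_
      rw [deleteEdges_sup]
      exact sup_le_sup le_rfl (deleteEdges_le _)
    · refine Adj.reachable ?_
      rw [← mem_edgeSet, edgeSet_exchangeEdge H f huv]
      exact Or.inr ⟨hab, hfab⟩

lemma IsAcyclic.exchangeEdge {H : SimpleGraph V} (hH : H.IsAcyclic) {u v : V} (huv : u ≠ v)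
    (hnadj : ¬ H.Adj u v) {p : H.Walk u v} (hp : p.IsPath) {f : Sym2 V} (hf : f ∈ p.edges) :
    (H.exchangeEdge f u v).IsAcyclic := by
  refine IsAcyclic.sup_edge_of_not_reachable (fun hreach ↦ ?_) (hH.anti (deleteEdges_le _))
  have hfH : f ∈ H.edgeSet := p.edges_subset_edgeSet hf
  have hbr := isAcyclic_iff_forall_isBridge.mp hH hfH
  induction f with | h x y
  rw [isBridge_iff] at hbr
  refine hbr (Reachable.of_forall_adj (fun a b hab ↦ ?_)
    ((reachable_exchangeEdge_iff huv hnadj hp hf x y).mpr (Adj.reachable hfH)))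
  rcases hab with hab | hab
  · exact hab.reachable
  · rw [edge_adj] at hab
    rcases hab.1 with ⟨rfl, rfl⟩ | ⟨rfl, rfl⟩
    · exact hreach
    · exact hreach.symm

/-- If every fibre of a surjection `V → Fin t` lies in a connected component of `H`, then `H` has
at least `|V| - t` edges. -/
lemma card_le_ncard_edgeSet_add [Finite V] [Nonempty V] (H : SimpleGraph V) {t : ℕ}
    {P : V → Fin t} (hP : P.Surjective) (hH : ∀ a b, P a = P b → H.Reachable a b) :
    Nat.card V ≤ H.edgeSet.ncard + t := by
  obtain ⟨r, hr⟩ := hP.hasRightInverse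
  let c : Fin t := P (Classical.arbitrary V)
  let S : Set (Sym2 V) := (fun i ↦ s(r c, r i)) '' {c}ᶜ
  have hreach : ∀ a, (H ⊔ fromEdgeSet S).Reachable (r c) a := fun a ↦ by
    have h1 : (H ⊔ fromEdgeSet S).Reachable (r (P a)) a :=
      (hH _ _ (hr (P a))).mono le_sup_left
    by_cases hc : P a = c
    · rwa [hc] at h1
    · refine Reachable.trans (Adj.reachable (Or.inr ?_)) h1
      rw [fromEdgeSet_adj]
      exact ⟨⟨P a, hc, rfl⟩, fun h ↦ hc (hr.injective h).symm⟩
  have hconn : (H ⊔ fromEdgeSet S).Connected :=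
    { preconnected := fun a b ↦ (hreach a).symm.trans (hreach b) }
  have hcard := hconn.card_vert_le_card_edgeSet_add_one
  rw [Nat.card_coe_set_eq, edgeSet_sup] at hcard
  have h2 := Set.ncard_union_le H.edgeSet (fromEdgeSet S).edgeSet
  have h3 : (fromEdgeSet S).edgeSet.ncard ≤ S.ncard :=
    Set.ncard_le_ncard (by simp) (Set.toFinite _)
  have h4 : S.ncard ≤ ({c}ᶜ : Set (Fin t)).ncard := Set.ncard_image_le (Set.toFinite _)
  have h5 := Set.ncard_add_ncard_compl ({c} : Set (Fin t))
  rw [Set.ncard_singleton, Nat.card_fin] at h5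
  omega

/-- A connected graph has at least `t - 1` edges joining different parts of a partition into `t`
parts. -/
lemma Connected.le_ncard_crossing [Finite V] {T : SimpleGraph V} (hT : T.Connected) {t : ℕ}
    {P : V → Fin t} (hP : P.Surjective) :
    t - 1 ≤ {e ∈ T.edgeSet | ¬ (Sym2.map P e).IsDiag}.ncard := by
  let Q : SimpleGraph (Fin t) := fromEdgeSet (Sym2.map P '' T.edgeSet)
  have hreach : ∀ a b, Q.Reachable (P a) (P b) := fun a b ↦ by
    obtain ⟨p⟩ := hT.preconnected a b
    induction p with
    | nil => exact Reachable.refl _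
    | @cons x y _ hadj _ ih =>
      refine Reachable.trans ?_ ih
      by_cases hxy : P x = P y
      · rw [hxy]
      · exact Adj.reachable ((fromEdgeSet_adj _).mpr ⟨⟨s(x, y), hadj, rfl⟩, hxy⟩)
  have hne : Nonempty (Fin t) := hT.nonempty.map P
  have hconn : Q.Connected :=
    { preconnected := fun i j ↦ by
        obtain ⟨a, rfl⟩ := hP i
        obtain ⟨b, rfl⟩ := hP j
        exact hreach a b }
  have hcard := hconn.card_vert_le_card_edgeSet_add_one
  rw [Nat.card_coe_set_eq, Nat.card_fin] at hcard
  have hsub : Q.edgeSet ⊆ Sym2.map P '' {e ∈ T.edgeSet | ¬ (Sym2.map P e).IsDiag} := by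
    rintro _ he
    rw [edgeSet_fromEdgeSet] at he
    obtain ⟨⟨e, heT, rfl⟩, hd⟩ := he
    exact ⟨e, ⟨heT, hd⟩, rfl⟩
  have h1 := Set.ncard_le_ncard hsub (Set.toFinite _)
  have h2 := Set.ncard_image_le (f := Sym2.map P)
    (Set.toFinite {e ∈ T.edgeSet | ¬ (Sym2.map P e).IsDiag})
  omega

/-- A family of pairwise edge-disjoint forests in `G`. -/
structure IsForestPacking (G : SimpleGraph V) (F : ι → SimpleGraph V) : Prop where
  le : ∀ i, F i ≤ G
  isAcyclic : ∀ i, (F i).IsAcyclic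
  eq_of_mem : ∀ {i j e}, e ∈ (F i).edgeSet → e ∈ (F j).edgeSet → i = j

/-- The edge `e` of `G` is used by no member of `F`. -/
def IsUnused (G : SimpleGraph V) (F : ι → SimpleGraph V) (e : Sym2 V) : Prop :=
  e ∈ G.edgeSet ∧ ∀ i, e ∉ (F i).edgeSet

lemma IsForestPacking.update [DecidableEq ι] {G : SimpleGraph V} {F : ι → SimpleGraph V}
    (hF : G.IsForestPacking F) {e : Sym2 V} (he : G.IsUnused F e) {j : ι} {H : SimpleGraph V}
    (hH : H.IsAcyclic) (hsub : H.edgeSet ⊆ insert e (F j).edgeSet) :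
    G.IsForestPacking (Function.update F j H) := by
  have key : ∀ {i e'}, e' ∈ (Function.update F j H i).edgeSet →
      (e' = e ∧ i = j) ∨ e' ∈ (F i).edgeSet := by
    intro i e' h
    by_cases hij : i = j
    · subst hij
      rw [Function.update_self] at h
      rcases hsub h with h | h
      · exact Or.inl ⟨h, rfl⟩
      · exact Or.inr h
    · rw [Function.update_of_ne hij] at h
      exact Or.inr h
  refine ⟨fun i ↦ ?_, fun i ↦ ?_, fun {i i' e'} h h₂ ↦ ?_⟩
  · rw [← edgeSet_subset_edgeSet]
    intro e' h
    rcases key h with ⟨rfl, _⟩ | h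
    · exact he.1
    · exact edgeSet_mono (hF.le i) h
  · by_cases hij : i = j
    · subst hij
      rwa [Function.update_self]
    · rw [Function.update_of_ne hij]
      exact hF.isAcyclic i
  · rcases key h with ⟨rfl, rfl⟩ | h <;> rcases key h₂ with ⟨h1, h2⟩ | h₂
    · exact h2.symm
    · exact absurd h₂ (he.2 _)
    · subst h1
      exact absurd h (he.2 _)
    · exact hF.eq_of_mem h h₂

/-- The total number of edges in a family of graphs. -/
noncomputable def totalEdges [Fintype ι] (F : ι → SimpleGraph V) : ℕ :=
  ∑ i, (F i).edgeSet.ncard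

/-- A forest packing with the largest possible number of edges. -/
structure IsMaxForestPacking [Fintype ι] (G : SimpleGraph V) (F : ι → SimpleGraph V) : Prop
    extends G.IsForestPacking F where
  totalEdges_le : ∀ F' : ι → SimpleGraph V, G.IsForestPacking F' → totalEdges F' ≤ totalEdges F

lemma exists_isMaxForestPacking [Finite V] [Fintype ι] (G : SimpleGraph V) :
    ∃ F : ι → SimpleGraph V, G.IsMaxForestPacking F := by
  have hbot : G.IsForestPacking (fun _ : ι ↦ (⊥ : SimpleGraph V)) :=
    ⟨fun _ ↦ bot_le, fun _ ↦ isAcyclic_bot, fun h ↦ by simp at h⟩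
  obtain ⟨F, hF, hmax⟩ := Set.exists_max_image {F : ι → SimpleGraph V | G.IsForestPacking F}
    totalEdges (Set.toFinite _) ⟨_, hbot⟩
  exact ⟨F, hF, hmax⟩

/-- In a maximum forest packing, the ends of an unused edge are connected in every forest. -/
lemma IsMaxForestPacking.reachable [Finite V] [Fintype ι] {G : SimpleGraph V}
    {F : ι → SimpleGraph V} (hF : G.IsMaxForestPacking F) {u v : V} (he : G.IsUnused F s(u, v))
    (j : ι) : (F j).Reachable u v := by
  classical
  by_contra hn
  have huv : u ≠ v := Adj.ne he.1
  have hedge : (F j ⊔ edge u v).edgeSet = insert s(u, v) (F j).edgeSet := by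
    rw [edgeSet_sup, edgeSet_edge_of_ne huv, Set.union_singleton]
  have hle := hF.totalEdges_le _ (hF.toIsForestPacking.update he (j := j)
    (IsAcyclic.sup_edge_of_not_reachable hn (hF.isAcyclic j)) hedge.subset)
  refine hle.not_gt (Finset.sum_lt_sum (fun i _ ↦ ?_) ⟨j, Finset.mem_univ j, ?_⟩)
  · by_cases hij : i = j
    · subst hij
      rw [Function.update_self, hedge]
      exact Set.ncard_le_ncard (Set.subset_insert _ _) (Set.toFinite _)
    · rw [Function.update_of_ne hij]
  · rw [Function.update_self, hedge, Set.ncard_insert_of_notMem (he.2 j) (Set.toFinite _)]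
    exact Nat.lt_succ_self _

/-- `F'` arises from `F` by exchanging an unused edge into one of the forests, in place of an edge
on the path joining its ends. -/
def ExchangeStep [DecidableEq ι] (G : SimpleGraph V) (F F' : ι → SimpleGraph V) : Prop :=
  ∃ (j : ι) (u v : V) (p : (F j).Walk u v) (f : Sym2 V), p.IsPath ∧ f ∈ p.edges ∧
    G.IsUnused F s(u, v) ∧ F' = Function.update F j ((F j).exchangeEdge f u v)

lemma IsMaxForestPacking.exchangeStep [Finite V] [Fintype ι] [DecidableEq ι] {G : SimpleGraph V}
    {F F' : ι → SimpleGraph V} (hF : G.IsMaxForestPacking F) (h : G.ExchangeStep F F') :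
    G.IsMaxForestPacking F' := by
  obtain ⟨j, u, v, p, f, hp, hf, he, rfl⟩ := h
  have huv : u ≠ v := Adj.ne he.1
  have hedge := edgeSet_exchangeEdge (F j) f huv
  have htotal : totalEdges (Function.update F j ((F j).exchangeEdge f u v)) = totalEdges F := by
    refine Finset.sum_congr rfl fun i _ ↦ ?_
    by_cases hij : i = j
    · subst hij
      rw [Function.update_self, hedge]
      exact Set.ncard_exchange (he.2 i) (p.edges_subset_edgeSet hf)
    · rw [Function.update_of_ne hij]
  refine ⟨hF.toIsForestPacking.update he ((hF.isAcyclic j).exchangeEdge huv (he.2 j) hp hf) ?_,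
    fun F'' h ↦ htotal ▸ hF.totalEdges_le F'' h⟩
  rw [hedge]
  exact Set.insert_subset_insert Set.sdiff_subset

/-- The edges that can be made unused by a sequence of exchanges starting at `F`. -/
def releasable [DecidableEq ι] (G : SimpleGraph V) (F : ι → SimpleGraph V) : Set (Sym2 V) :=
  {e | ∃ F', Relation.ReflTransGen G.ExchangeStep F F' ∧ G.IsUnused F' e}

section Releasable

variable [Fintype ι] [DecidableEq ι] {G : SimpleGraph V} {F F' : ι → SimpleGraph V}

lemma IsMaxForestPacking.reflTransGen [Finite V] (hF : G.IsMaxForestPacking F)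
    (h : Relation.ReflTransGen G.ExchangeStep F F') : G.IsMaxForestPacking F' := by
  induction h with
  | refl => exact hF
  | tail _ hstep ih => exact ih.exchangeStep hstep

/-- All edges on a path joining the ends of an unused edge are releasable. -/
lemma mem_releasable_of_mem_edges (h : Relation.ReflTransGen G.ExchangeStep F F')
    (hF' : G.IsMaxForestPacking F')
    {u v : V} (he : G.IsUnused F' s(u, v)) {j : ι} {p : (F' j).Walk u v} (hp : p.IsPath)
    {f : Sym2 V} (hf : f ∈ p.edges) : f ∈ G.releasable F := by
  have hfF : f ∈ (F' j).edgeSet := p.edges_subset_edgeSet hf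
  refine ⟨_, h.tail ⟨j, u, v, p, f, hp, hf, he, rfl⟩, edgeSet_mono (hF'.le j) hfF, fun i hi ↦ ?_⟩
  by_cases hij : i = j
  · subst hij
    rw [Function.update_self, edgeSet_exchangeEdge _ _ (Adj.ne he.1)] at hi
    rcases hi with rfl | hi
    · exact he.2 i hfF
    · exact hi.2 rfl
  · rw [Function.update_of_ne hij] at hi
    exact hij (hF'.eq_of_mem hi hfF)

/-- Exchanges preserve reachability inside the releasable part of each forest. -/
lemma reachable_inf_releasable_iff [Finite V] (hF : G.IsMaxForestPacking F)
    (h : Relation.ReflTransGen G.ExchangeStep F F') (i : ι) (a b : V) :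
    (F' i ⊓ fromEdgeSet (G.releasable F)).Reachable a b ↔
      (F i ⊓ fromEdgeSet (G.releasable F)).Reachable a b := by
  induction h with
  | refl => rfl
  | @tail F₁ F₂ h hstep ih =>
    rw [← ih]
    have hF₁ := hF.reflTransGen h
    obtain ⟨j, u, v, p, f, hp, hf, he, rfl⟩ := hstep
    by_cases hij : i = j
    swap
    · rw [Function.update_of_ne hij]
    subst hij
    rw [Function.update_self]
    have huv : u ≠ v := Adj.ne he.1
    have hmem : ∀ e ∈ p.edges, e ∈ (F₁ i ⊓ fromEdgeSet (G.releasable F)).edgeSet := by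
      intro e hep
      have heF : e ∈ (F₁ i).edgeSet := p.edges_subset_edgeSet hep
      rw [edgeSet_inf, edgeSet_fromEdgeSet]
      exact ⟨heF, mem_releasable_of_mem_edges h hF₁ he hp hep,
        not_isDiag_of_mem_edgeSet _ heF⟩
    have hq : (p.transfer _ hmem).IsPath := hp.transfer hmem
    have hnadj : ¬ (F₁ i ⊓ fromEdgeSet (G.releasable F)).Adj u v := fun hadj ↦ he.2 i hadj.1
    rw [← reachable_exchangeEdge_iff huv hnadj hq (f := f) (by rwa [Walk.edges_transfer])]
    have hgraph : (F₁ i).exchangeEdge f u v ⊓ fromEdgeSet (G.releasable F) =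
        (F₁ i ⊓ fromEdgeSet (G.releasable F)).exchangeEdge f u v := by
      rw [← edgeSet_inj, edgeSet_inf, edgeSet_exchangeEdge _ _ huv, edgeSet_exchangeEdge _ _ huv,
        edgeSet_inf, edgeSet_fromEdgeSet]
      have hmemD : s(u, v) ∈ G.releasable F \ Sym2.diagSet :=
        ⟨⟨F₁, h, he⟩, not_isDiag_of_mem_edgeSet _ he.1⟩
      rw [Set.insert_inter_of_mem hmemD, Set.inter_sdiff_right_comm]
    rw [hgraph]

/-- In a maximum forest packing, the releasable part of every forest connects the ends of every
releasable edge. -/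
lemma IsMaxForestPacking.reachable_inf_releasable [Finite V] (hF : G.IsMaxForestPacking F) {u v : V}
    (he : s(u, v) ∈ G.releasable F) (i : ι) :
    (F i ⊓ fromEdgeSet (G.releasable F)).Reachable u v := by
  obtain ⟨F', h, he⟩ := he
  rw [← reachable_inf_releasable_iff hF h]
  have hF' := hF.reflTransGen h
  obtain ⟨p, hp⟩ := (hF'.reachable he i).exists_isPath
  refine ⟨p.transfer _ fun e hep ↦ ?_⟩
  have heF : e ∈ (F' i).edgeSet := p.edges_subset_edgeSet hep
  rw [edgeSet_inf, edgeSet_fromEdgeSet]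
  exact ⟨heF, mem_releasable_of_mem_edges h hF' he hp hep, not_isDiag_of_mem_edgeSet _ heF⟩

end Releasable

lemma IsAcyclic.ncard_edgeSet_add_one_le [Finite V] [Nonempty V] {H : SimpleGraph V}
    (hH : H.IsAcyclic) :
    H.edgeSet.ncard + 1 ≤ Nat.card V ∧ (H.edgeSet.ncard + 1 = Nat.card V → H.IsTree) := by
  obtain ⟨T, hHT, -, hT⟩ := connected_top.exists_isTree_le_of_le_of_isAcyclic le_top hH
  have hcard := (isTree_iff_connected_and_card.mp hT).2
  rw [Nat.card_coe_set_eq] at hcard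
  have hsub : H.edgeSet ⊆ T.edgeSet := edgeSet_mono hHT
  refine ⟨hcard ▸ Nat.succ_le_succ (Set.ncard_le_ncard hsub (Set.toFinite _)), fun h ↦ ?_⟩
  have : H = T := edgeSet_injective
    (Set.eq_of_subset_of_ncard_le hsub (by omega) (Set.toFinite _))
  exact this ▸ hT

/-- If every partition into `t` parts is crossed by at least `k (t - 1)` edges, then a maximum
packing of `k` forests consists of spanning trees. -/
lemma IsMaxForestPacking.isTree [Finite V] [Nonempty V] {G : SimpleGraph V} {k : ℕ}
    {F : Fin k → SimpleGraph V} (hF : G.IsMaxForestPacking F)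
    (hG : ∀ (t : ℕ) (P : V → Fin t), Function.Surjective P →
      k * (t - 1) ≤ {e ∈ G.edgeSet | ¬ (Sym2.map P e).IsDiag}.ncard) (i : Fin k) :
    (F i).IsTree := by
  let D : SimpleGraph V := fromEdgeSet (G.releasable F)
  have : Fintype D.ConnectedComponent := Fintype.ofFinite _
  let P : V → Fin (Fintype.card D.ConnectedComponent) :=
    fun v ↦ Fintype.equivFin _ (D.connectedComponentMk v)
  have hP : P.Surjective := (Equiv.surjective _).comp Quot.mk_surjective
  have hPD : ∀ {a b}, P a = P b ↔ D.Reachable a b := by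
    intro a b
    simp [P]
  have hreach : ∀ j a b, P a = P b → (F j ⊓ D).Reachable a b := fun j a b hab ↦
    Reachable.of_forall_adj
      (fun x y hxy ↦ hF.reachable_inf_releasable ((fromEdgeSet_adj _).mp hxy).1 j) (hPD.mp hab)
  have hcross : {e ∈ G.edgeSet | ¬ (Sym2.map P e).IsDiag} ⊆
      ⋃ j, (F j).edgeSet \ (F j ⊓ D).edgeSet := by
    rintro ⟨a, b⟩ ⟨heG, hd⟩
    have hnD : ¬ D.Adj a b := fun hab ↦ hd (hPD.mpr hab.reachable)
    have hused : ¬ G.IsUnused F s(a, b) := fun h ↦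
      hnD ((fromEdgeSet_adj _).mpr ⟨⟨F, .refl, h⟩, Adj.ne heG⟩)
    simp only [IsUnused, not_and, not_forall, not_not] at hused
    obtain ⟨j, hj⟩ := hused heG
    exact Set.mem_iUnion.mpr ⟨j, hj, fun h ↦ hnD h.2⟩
  have hcount : k * (Fintype.card D.ConnectedComponent - 1) ≤
      ∑ j, ((F j).edgeSet \ (F j ⊓ D).edgeSet).ncard :=
    (hG _ P hP).trans <| (Set.ncard_le_ncard hcross (Set.toFinite _)).trans <|
      Set.ncard_iUnion_le_of_fintype _
  have hpos : 0 < Fintype.card D.ConnectedComponent := Fintype.card_pos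
  have hsplit : ∀ j, ((F j).edgeSet \ (F j ⊓ D).edgeSet).ncard + Nat.card V ≤
      (F j).edgeSet.ncard + Fintype.card D.ConnectedComponent := fun j ↦ by
    have h1 := (F j ⊓ D).card_le_ncard_edgeSet_add hP (hreach j)
    have h2 := Set.ncard_sdiff_add_ncard_of_subset
      (edgeSet_mono (inf_le_left : F j ⊓ D ≤ F j)) (Set.toFinite _)
    omega
  have hle : ∀ j, (F j).edgeSet.ncard + 1 ≤ Nat.card V := fun j ↦
    (hF.isAcyclic j).ncard_edgeSet_add_one_le.1
  refine (hF.isAcyclic i).ncard_edgeSet_add_one_le.2 ((hle i).antisymm (not_lt.mp fun hlt ↦ ?_))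
  have hsum : ∑ j, ((F j).edgeSet \ (F j ⊓ D).edgeSet).ncard <
      ∑ _j : Fin k, (Fintype.card D.ConnectedComponent - 1) := by
    refine Finset.sum_lt_sum (fun j _ ↦ ?_) ⟨i, Finset.mem_univ i, ?_⟩
    · have := hsplit j
      have := hle j
      omega
    · have := hsplit i
      omega
  rw [Finset.sum_const, Finset.card_univ, Fintype.card_fin, smul_eq_mul] at hsum
  omega

end SimpleGraph

open SimpleGraph in
/-- The Nash-Williams/Tutte spanning tree packing theorem: a connected graph `G`
contains `k` edge-disjoint spanning trees iff for every partition of the vertex set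
(given by the fibers of a surjection onto `Fin t`), the number of edges joining
different parts is at least `k(t-1)`. -/
theorem stmt14 {V : Type*} [Fintype V] (G : SimpleGraph V) (hconn : G.Connected)
    (k : ℕ) :
    (∃ T : Fin k → SimpleGraph V,
        (∀ i, T i ≤ G ∧ (T i).IsTree) ∧
        ∀ i j, i ≠ j → Disjoint (T i).edgeSet (T j).edgeSet)
    ↔ ∀ (t : ℕ) (P : V → Fin t), Function.Surjective P →
        k * (t - 1) ≤ {e ∈ G.edgeSet | ¬ (Sym2.map P e).IsDiag}.ncard := by
  have : Nonempty V := hconn.nonempty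
  constructor
  · rintro ⟨T, hT, hdisj⟩ t P hP
    have hsub : (⋃ i, {e ∈ (T i).edgeSet | ¬ (Sym2.map P e).IsDiag}) ⊆
        {e ∈ G.edgeSet | ¬ (Sym2.map P e).IsDiag} :=
      Set.iUnion_subset fun i e he ↦ ⟨edgeSet_mono (hT i).1 he.1, he.2⟩
    refine le_trans ?_ (Set.ncard_le_ncard hsub (Set.toFinite _))
    rw [Set.ncard_iUnion_of_finite (fun i ↦ Set.toFinite _)
      (fun i j hij ↦ (hdisj i j hij).mono (Set.sep_subset _ _) (Set.sep_subset _ _)),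
      finsum_eq_sum_of_fintype]
    calc k * (t - 1) = ∑ _i : Fin k, (t - 1) := by simp
      _ ≤ _ := Finset.sum_le_sum fun i _ ↦ (hT i).2.connected.le_ncard_crossing hP
  · intro h
    obtain ⟨F, hF⟩ := G.exists_isMaxForestPacking (ι := Fin k)
    exact ⟨F, fun i ↦ ⟨hF.le i, hF.isTree h i⟩, fun i j hij ↦
      Set.disjoint_left.mpr fun e hi hj ↦ hij (hF.eq_of_mem hi hj)⟩
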